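/- Let p>2, let u be a nonnegative classical solution of u_t−Δu=|∇u|^p in Q_T with u=0 on Γ_T, having an isolated gradient blowup point at (0,0,T) and satisfying the monotonicity condition x·u_x≤0 in Q_T. Then there exist a constant C₁>0 and ρ>0 such that, with β=1/(p−1), d_p=β^β and c_p=d_p/(1−β): (i) u_y(0,y,t) ≥ [(u_y(0,0,t))^{1−p}+(p−1)y]^{−β}−C₁ for all 0<y<ρ and T−ρ≤t<T; (ii) u_y(0,y,T) ≥ d_p y^{−β}−C₁ for 0<y<ρ; (iii) u(0,y,T) ≥ c_p y^{1−β}−C₁y for 0<y<ρ. -/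

import Mathlib

open Real Set Filter MeasureTheory

noncomputable section

/-- Partial derivative of `u(x,y,t)` with respect to `x`. -/
def pdx (u : ℝ → ℝ → ℝ → ℝ) (x y t : ℝ) : ℝ := deriv (fun s => u s y t) x

/-- Partial derivative with respect to `y`. -/
def pdy (u : ℝ → ℝ → ℝ → ℝ) (x y t : ℝ) : ℝ := deriv (fun s => u x s t) y

/-- Partial derivative with respect to `t`. -/
def pdt (u : ℝ → ℝ → ℝ → ℝ) (x y t : ℝ) : ℝ := deriv (fun s => u x y s) t

/-- Second partial derivative with respect to `x`. -/
def pdxx (u : ℝ → ℝ → ℝ → ℝ) (x y t : ℝ) : ℝ := deriv (fun s => pdx u s y t) x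

/-- Second partial derivative with respect to `y`. -/
def pdyy (u : ℝ → ℝ → ℝ → ℝ) (x y t : ℝ) : ℝ := deriv (fun s => pdy u x s t) y

/-- Mixed second partial derivative `u_{xy}` (first `x`, then `y`). -/
def pdxy (u : ℝ → ℝ → ℝ → ℝ) (x y t : ℝ) : ℝ := deriv (fun s => pdx u x s t) y

/-- The norm of the spatial gradient, `|∇u| = (u_x² + u_y²)^{1/2}`. -/
def gradNorm (u : ℝ → ℝ → ℝ → ℝ) (x y t : ℝ) : ℝ :=
  Real.sqrt ((pdx u x y t) ^ 2 + (pdy u x y t) ^ 2)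

/-- `C^{2,1}`-type regularity of `u` at the point `(x,y,t)`: twice (continuously)
differentiable in the space variables and once in time. -/
def C21At (u : ℝ → ℝ → ℝ → ℝ) (x y t : ℝ) : Prop :=
  DifferentiableAt ℝ (fun s => u s y t) x ∧
  DifferentiableAt ℝ (fun s => u x s t) y ∧
  DifferentiableAt ℝ (fun s => u x y s) t ∧
  DifferentiableAt ℝ (fun s => pdx u s y t) x ∧
  DifferentiableAt ℝ (fun s => pdy u x s t) y ∧
  DifferentiableAt ℝ (fun s => pdx u x s t) y ∧
  ContinuousAt (fun q : ℝ × ℝ × ℝ => u q.1 q.2.1 q.2.2) (x, y, t) ∧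
  ContinuousAt (fun q : ℝ × ℝ × ℝ => pdx u q.1 q.2.1 q.2.2) (x, y, t) ∧
  ContinuousAt (fun q : ℝ × ℝ × ℝ => pdy u q.1 q.2.1 q.2.2) (x, y, t) ∧
  ContinuousAt (fun q : ℝ × ℝ × ℝ => pdt u q.1 q.2.1 q.2.2) (x, y, t) ∧
  ContinuousAt (fun q : ℝ × ℝ × ℝ => pdxx u q.1 q.2.1 q.2.2) (x, y, t) ∧
  ContinuousAt (fun q : ℝ × ℝ × ℝ => pdyy u q.1 q.2.1 q.2.2) (x, y, t) ∧
  ContinuousAt (fun q : ℝ × ℝ × ℝ => pdxy u q.1 q.2.1 q.2.2) (x, y, t)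

/-- `u` is a nonnegative classical solution of `u_t - Δu = |∇u|^p` in
`Q_T = ω × (0,T)`, `ω = (-L,L) × (0,L)`, with `u = 0` on `Γ_T = (-L,L) × {0} × (0,T)`. -/
structure ClassicalSolution (p L T : ℝ) (u : ℝ → ℝ → ℝ → ℝ) : Prop where
  nonneg : ∀ ⦃x y t : ℝ⦄, |x| ≤ L → y ∈ Icc (0:ℝ) L → t ∈ Ioo 0 T → 0 ≤ u x y t
  smooth : ∀ ⦃x y t : ℝ⦄, |x| ≤ L → y ∈ Icc (0:ℝ) L → t ∈ Ioo 0 T → C21At u x y t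
  pde : ∀ ⦃x y t : ℝ⦄, |x| < L → y ∈ Ioo (0:ℝ) L → t ∈ Ioo 0 T →
    pdt u x y t - (pdxx u x y t + pdyy u x y t) = gradNorm u x y t ^ p
  bc : ∀ ⦃x t : ℝ⦄, |x| < L → t ∈ Ioo 0 T → u x 0 t = 0

/-- `u` has an isolated gradient blow-up point at `(0,0,T)`:
`limsup |∇u| = ∞` at `(0,0,T)` while `∇u` stays bounded on `K × (0,T)` for every
compact `K ⊆ ω̄ \ {(0,0)}`. -/
structure IsolatedGBU (L T : ℝ) (u : ℝ → ℝ → ℝ → ℝ) : Prop where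
  blowup : ∀ M : ℝ, ∀ δ > (0:ℝ), ∃ x y t : ℝ, |x| ≤ L ∧ y ∈ Icc (0:ℝ) L ∧
    t ∈ Ioo 0 T ∧ |x| < δ ∧ |y| < δ ∧ T - δ < t ∧ M < gradNorm u x y t
  bounded : ∀ K : Set (ℝ × ℝ), IsCompact K →
    K ⊆ (Icc (-L) L ×ˢ Icc (0:ℝ) L) \ {((0:ℝ), (0:ℝ))} →
    ∃ M : ℝ, ∀ q ∈ K, ∀ t ∈ Ioo (0:ℝ) T, gradNorm u q.1 q.2 t ≤ M

/-- `u` extends as a `C^{2,1}` function to `(ω̄' × [T/2,T]) \ {(0,0,T)}`,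
`ω' = (-L/2,L/2) × (0,L/2)`; values and derivatives at `t = T` refer to this extension. -/
def ExtC21 (L T : ℝ) (u : ℝ → ℝ → ℝ → ℝ) : Prop :=
  ∀ ⦃x y t : ℝ⦄, |x| ≤ L / 2 → y ∈ Icc (0:ℝ) (L / 2) → t ∈ Icc (T / 2) T →
    ¬(x = 0 ∧ y = 0 ∧ t = T) → C21At u x y t

/-- The monotonicity condition `x·u_x ≤ 0` in `Q_T`. -/
def MonCond (L T : ℝ) (u : ℝ → ℝ → ℝ → ℝ) : Prop :=
  ∀ ⦃x y t : ℝ⦄, |x| < L → y ∈ Ioo (0:ℝ) L → t ∈ Ioo 0 T → x * pdx u x y t ≤ 0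

lemma D2aux (f : ℝ → ℝ) (x0 : ℝ) (hf : ContinuousAt f x0) (hm : IsLocalMax f x0) :
    deriv (deriv f) x0 ≤ 0 := by
  by_contra! h
  have h0 : deriv f x0 = 0 := hm.deriv_eq_zero
  have hmin := isLocalMin_of_deriv_deriv_pos h h0 hf
  have hconst : f =ᶠ[nhds x0] fun _ => f x0 := by
    filter_upwards [hm, hmin] with x h1 h2 using le_antisymm h1 h2
  have h3 : deriv f =ᶠ[nhds x0] deriv (fun _ => f x0) := hconst.deriv
  have h4 := h3.deriv_eq
  simp at h4
  linarith

lemma D2 (f g : ℝ → ℝ) (x0 : ℝ) (hf : ∀ᶠ x in nhds x0, DifferentiableAt ℝ f x)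
    (hg : ∀ᶠ x in nhds x0, DifferentiableAt ℝ g x)
    (hf2 : DifferentiableAt ℝ (deriv f) x0) (hg2 : DifferentiableAt ℝ (deriv g) x0)
    (hm : IsLocalMax (fun x => f x - g x) x0) :
    deriv f x0 = deriv g x0 ∧ deriv (deriv f) x0 ≤ deriv (deriv g) x0 := by
  have hd : deriv (fun x => f x - g x) =ᶠ[nhds x0] fun x => deriv f x - deriv g x := by
    filter_upwards [hf, hg] with x h1 h2
    exact deriv_fun_sub h1 h2
  constructor
  · have h0 := hm.deriv_eq_zero
    rw [hd.self_of_nhds] at h0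
    linarith
  · have h1 := D2aux _ x0 (hf.self_of_nhds.continuousAt.sub hg.self_of_nhds.continuousAt) hm
    change deriv (deriv (fun x => f x - g x)) x0 ≤ 0 at h1
    rw [hd.deriv_eq, deriv_fun_sub hf2 hg2] at h1
    linarith

/-- left-max in time -/
lemma D1left (g : ℝ → ℝ) (t a : ℝ) (ha : a < t) (hg : DifferentiableAt ℝ g t)
    (hm : ∀ s ∈ Ioo a t, g s ≤ g t) : 0 ≤ deriv g t := by
  have h := hg.hasDerivAt.hasDerivWithinAt (s := Iio t)
  rw [hasDerivWithinAt_iff_tendsto_slope] at h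
  have e : Iio t \ {t} = Iio t := by ext; simp
  rw [e] at h
  refine ge_of_tendsto h ?_
  filter_upwards [Ioo_mem_nhdsLT ha] with s hs
  rw [slope_def_field]
  exact div_nonneg_of_nonpos (by linarith [hm s hs]) (by linarith [hs.2])

lemma D1right (g : ℝ → ℝ) (t K d : ℝ) (hd : 0 < d) (hg : DifferentiableAt ℝ g t)
    (hm : ∀ h, 0 < h → h < d → g (t + h) - g t ≤ K * h) : deriv g t ≤ K := by
  have h := hg.hasDerivAt.hasDerivWithinAt (s := Ioi t)
  rw [hasDerivWithinAt_iff_tendsto_slope] at h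
  have e : Ioi t \ {t} = Ioi t := by ext; simp
  rw [e] at h
  refine le_of_tendsto h ?_
  filter_upwards [Ioo_mem_nhdsGT (show t < t + d by linarith)] with s hs
  rw [slope_def_field, div_le_iff₀ (by linarith [hs.1])]
  have := hm (s - t) (by linarith [hs.1]) (by linarith [hs.2])
  simpa using this

lemma D1right' (g : ℝ → ℝ) (t K d : ℝ) (hd : 0 < d) (hg : DifferentiableAt ℝ g t)
    (hm : ∀ h, 0 < h → h < d → g t - g (t + h) ≤ K * h) : -K ≤ deriv g t := by
  have := D1right (fun s => - g s) t K d hd hg.neg (fun h h1 h2 => by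
    have := hm h h1 h2
    linarith)
  rw [deriv.fun_neg] at this
  linarith

def Reg (w : ℝ → ℝ → ℝ → ℝ) (x y t : ℝ) : Prop :=
  DifferentiableAt ℝ (fun s => w s y t) x ∧
  DifferentiableAt ℝ (fun s => w x s t) y ∧
  DifferentiableAt ℝ (fun s => w x y s) t ∧
  DifferentiableAt ℝ (fun s => pdx w s y t) x ∧
  DifferentiableAt ℝ (fun s => pdy w x s t) y

lemma CP (F : ℝ → ℝ → ℝ) (w1 w2 : ℝ → ℝ → ℝ → ℝ) (l b t1 t2 c : ℝ)
    (hc1 : ContinuousOn (fun q : ℝ × ℝ × ℝ => w1 q.1 q.2.1 q.2.2)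
      (Icc (-l) l ×ˢ Icc 0 b ×ˢ Icc t1 t2))
    (hc2 : ContinuousOn (fun q : ℝ × ℝ × ℝ => w2 q.1 q.2.1 q.2.2)
      (Icc (-l) l ×ˢ Icc 0 b ×ˢ Icc t1 t2))
    (hr1 : ∀ x ∈ Ioo (-l) l, ∀ y ∈ Ioo 0 b, ∀ t ∈ Ioc t1 t2, Reg w1 x y t)
    (hr2 : ∀ x ∈ Ioo (-l) l, ∀ y ∈ Ioo 0 b, ∀ t ∈ Ioc t1 t2, Reg w2 x y t)
    (h1 : ∀ x ∈ Ioo (-l) l, ∀ y ∈ Ioo 0 b, ∀ t ∈ Ioc t1 t2,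
      pdt w1 x y t - (pdxx w1 x y t + pdyy w1 x y t) ≤ F (pdx w1 x y t) (pdy w1 x y t))
    (h2 : ∀ x ∈ Ioo (-l) l, ∀ y ∈ Ioo 0 b, ∀ t ∈ Ioc t1 t2,
      F (pdx w2 x y t) (pdy w2 x y t) ≤ pdt w2 x y t - (pdxx w2 x y t + pdyy w2 x y t))
    (hb : ∀ x ∈ Icc (-l) l, ∀ y ∈ Icc 0 b, ∀ t ∈ Icc t1 t2,
      (x = -l ∨ x = l ∨ y = 0 ∨ y = b ∨ t = t1) → w1 x y t ≤ w2 x y t + c) :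
    ∀ x ∈ Icc (-l) l, ∀ y ∈ Icc 0 b, ∀ t ∈ Icc t1 t2, w1 x y t ≤ w2 x y t + c := by
  intro x0 hx0 y0 hy0 t0 ht0
  by_contra! hcon
  obtain ⟨ε, hε, hε2⟩ : ∃ ε > 0, ε * (t0 - t1) < w1 x0 y0 t0 - (w2 x0 y0 t0 + c) := by
    refine ⟨(w1 x0 y0 t0 - (w2 x0 y0 t0 + c)) / (2 * (t0 - t1 + 1)), ?_, ?_⟩
    · apply div_pos (by linarith)
      linarith [ht0.1]
    · have : 0 < 2 * (t0 - t1 + 1) := by linarith [ht0.1]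
      rw [div_mul_eq_mul_div, div_lt_iff₀ this]
      have := ht0.1
      nlinarith
  set B : Set (ℝ × ℝ × ℝ) := Icc (-l) l ×ˢ Icc 0 b ×ˢ Icc t1 t2 with hB
  have hBc : IsCompact B := isCompact_Icc.prod (isCompact_Icc.prod isCompact_Icc)
  obtain ⟨⟨x, y, t⟩, hq, hmax⟩ := hBc.exists_isMaxOn (f := fun q : ℝ × ℝ × ℝ =>
      w1 q.1 q.2.1 q.2.2 - w2 q.1 q.2.1 q.2.2 - ε * (q.2.2 - t1)) ⟨(x0, y0, t0), hx0, hy0, ht0⟩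
      ((hc1.sub hc2).sub (by fun_prop))
  obtain ⟨hx, hy, ht⟩ := hq
  simp only at hx hy ht
  have hM : ∀ x' ∈ Icc (-l) l, ∀ y' ∈ Icc 0 b, ∀ t' ∈ Icc t1 t2,
      w1 x' y' t' - w2 x' y' t' - ε * (t' - t1) ≤ w1 x y t - w2 x y t - ε * (t - t1) :=
    fun x' hx' y' hy' t' ht' => hmax (show (x', y', t') ∈ B from ⟨hx', hy', ht'⟩)
  have hpos := hM x0 hx0 y0 hy0 t0 ht0
  have hnb : ¬ (x = -l ∨ x = l ∨ y = 0 ∨ y = b ∨ t = t1) := by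
    intro h
    have := hb x hx y hy t ht h
    have : 0 ≤ ε * (t - t1) := mul_nonneg hε.le (by linarith [ht.1])
    linarith
  push Not at hnb
  obtain ⟨n1, n2, n3, n4, n5⟩ := hnb
  have hx' : x ∈ Ioo (-l) l := ⟨lt_of_le_of_ne hx.1 (Ne.symm n1), lt_of_le_of_ne hx.2 n2⟩
  have hy' : y ∈ Ioo 0 b := ⟨lt_of_le_of_ne hy.1 (Ne.symm n3), lt_of_le_of_ne hy.2 n4⟩
  have ht' : t ∈ Ioc t1 t2 := ⟨lt_of_le_of_ne ht.1 (Ne.symm n5), ht.2⟩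
  have nx : Ioo (-l) l ∈ nhds x := Ioo_mem_nhds hx'.1 hx'.2
  have ny : Ioo 0 b ∈ nhds y := Ioo_mem_nhds hy'.1 hy'.2
  obtain ⟨ex, exx⟩ := D2 (fun s => w1 s y t) (fun s => w2 s y t) x
    (by filter_upwards [nx] with s hs using (hr1 s hs y hy' t ht').1)
    (by filter_upwards [nx] with s hs using (hr2 s hs y hy' t ht').1)
    (hr1 x hx' y hy' t ht').2.2.2.1 (hr2 x hx' y hy' t ht').2.2.2.1
    (by filter_upwards [nx] with s hs
        have := hM s (Ioo_subset_Icc_self hs) y hy t ht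
        linarith)
  obtain ⟨ey, eyy⟩ := D2 (fun s => w1 x s t) (fun s => w2 x s t) y
    (by filter_upwards [ny] with s hs using (hr1 x hx' s hs t ht').2.1)
    (by filter_upwards [ny] with s hs using (hr2 x hx' s hs t ht').2.1)
    (hr1 x hx' y hy' t ht').2.2.2.2 (hr2 x hx' y hy' t ht').2.2.2.2
    (by filter_upwards [ny] with s hs
        have := hM x hx s (Ioo_subset_Icc_self hs) t ht
        linarith)
  have d1 := (hr1 x hx' y hy' t ht').2.2.1
  have d2 := (hr2 x hx' y hy' t ht').2.2.1
  have et := D1left (fun s => w1 x y s - w2 x y s - ε * (s - t1)) t t1 ht'.1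
    ((d1.sub d2).sub (by fun_prop))
    (fun s hs => hM x hx y hy s ⟨hs.1.le, hs.2.le.trans ht.2⟩)
  have hder : deriv (fun s => w1 x y s - w2 x y s - ε * (s - t1)) t
      = pdt w1 x y t - pdt w2 x y t - ε := by
    have h := (d1.hasDerivAt.sub d2.hasDerivAt).sub
      (((hasDerivAt_id t).sub_const t1).const_mul ε)
    have := h.deriv
    simp only [mul_one] at this
    exact this
  rw [hder] at et
  have q1 := h1 x hx' y hy' t ht'
  have q2 := h2 x hx' y hy' t ht'
  have ex' : pdx w1 x y t = pdx w2 x y t := ex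
  have ey' : pdy w1 x y t = pdy w2 x y t := ey
  have exx' : pdxx w1 x y t ≤ pdxx w2 x y t := exx
  have eyy' : pdyy w1 x y t ≤ pdyy w2 x y t := eyy
  rw [ex', ey'] at q1
  linarith

lemma ode_cmp (p C b : ℝ) (hp : 2 < p) (hC : 0 ≤ C) (hCb : (C + 2) * b ≤ 1)
    (v v' : ℝ → ℝ) (hv : ∀ y ∈ Icc 0 b, HasDerivAt v (v' y) y)
    (hv' : ∀ y ∈ Ico 0 b, -C - |v y| ^ p ≤ v' y) (h0 : 0 < v 0) :
    ∀ y ∈ Icc 0 b, ((v 0) ^ (1 - p) + (p - 1) * y) ^ (-(1/(p-1))) - (C + 2) * y ≤ v y := by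
  set m := (v 0) ^ (1 - p) with hm
  have hmpos : 0 < m := Real.rpow_pos_of_pos h0 _
  have hp1 : 0 < p - 1 := by linarith
  have hbase : ∀ y, 0 ≤ y → 0 < m + (p - 1) * y := fun y hy => by positivity
  set ψ : ℝ → ℝ := fun y => (m + (p - 1) * y) ^ (-(1/(p-1))) with hψ
  have hψd : ∀ y, 0 ≤ y → HasDerivAt ψ (-(ψ y) ^ p) y := by
    intro y hy
    have h1 : HasDerivAt (fun y => m + (p - 1) * y) (p - 1) y := by
      simpa using ((hasDerivAt_id y).const_mul (p - 1)).const_add m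
    have h2 := h1.rpow_const (p := -(1/(p-1))) (Or.inl (hbase y hy).ne')
    convert h2 using 1
    rw [hψ]
    simp only
    rw [← Real.rpow_mul (hbase y hy).le]
    have : -(1 / (p - 1)) * p = -(1 / (p - 1)) - 1 := by field_simp; ring
    rw [this]
    field_simp
  have hψ0 : ψ 0 = v 0 := by
    simp only [hψ, mul_zero, add_zero, hm]
    rw [← Real.rpow_mul h0.le]
    have : (1 - p) * -(1 / (p - 1)) = 1 := by field_simp; ring
    rw [this, Real.rpow_one]
  have hψpos : ∀ y, 0 ≤ y → 0 < ψ y := fun y hy => Real.rpow_pos_of_pos (hbase y hy) _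
  have hzd : ∀ y, 0 ≤ y → HasDerivAt (fun y => ψ y - (C + 2) * y) (-(ψ y) ^ p - (C + 2)) y := by
    intro y hy
    have := (hψd y hy).sub ((hasDerivAt_id y).const_mul (C + 2))
    rw [mul_one] at this
    exact this
  intro y hy
  refine image_le_of_deriv_right_lt_deriv_boundary' (f := fun y => ψ y - (C + 2) * y)
    (f' := fun y => -(ψ y) ^ p - (C + 2)) (a := 0) (b := b) (B := v) (B' := v')
    (fun y hy => (hzd y hy.1).continuousAt.continuousWithinAt)
    (fun y hy => (hzd y hy.1).hasDerivWithinAt) (by simp [hψ0])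
    (fun y hy => (hv y hy).continuousAt.continuousWithinAt)
    (fun y hy => (hv y ⟨hy.1, hy.2.le⟩).hasDerivWithinAt) ?_ hy
  intro y hy heq
  have h1 := hv' y hy
  have hyp := hψpos y hy.1
  have h2 : |v y| ^ p ≤ (ψ y) ^ p + 1 := by
    rw [← heq]
    have hCy : (C + 2) * y ≤ 1 := le_trans (mul_le_mul_of_nonneg_left hy.2.le (by linarith)) hCb
    have hCy0 : 0 ≤ (C + 2) * y := mul_nonneg (by linarith) hy.1
    have hpp : 0 ≤ (ψ y) ^ p := (Real.rpow_pos_of_pos hyp p).le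
    rcases le_total (|ψ y - (C + 2) * y|) 1 with h | h
    · have := Real.rpow_le_one (abs_nonneg _) h (by linarith : 0 ≤ p)
      linarith
    · have : |ψ y - (C + 2) * y| ≤ max 1 (ψ y) := by
        rw [abs_le]
        constructor
        · have := le_max_left 1 (ψ y); linarith
        · have := le_max_right 1 (ψ y); linarith
      rcases le_total 1 (ψ y) with h' | h'
      · rw [max_eq_right h'] at this
        have := Real.rpow_le_rpow (abs_nonneg _) this (by linarith : 0 ≤ p)
        linarith
      · rw [max_eq_left h'] at this
        have := Real.rpow_le_one (abs_nonneg _) this (by linarith : 0 ≤ p)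
        linarith
  linarith

def sh (u : ℝ → ℝ → ℝ → ℝ) (a1 a2 a3 : ℝ) : ℝ → ℝ → ℝ → ℝ :=
  fun x y t => u (x + a1) (y + a2) (t + a3)

lemma sh_pdx (u : ℝ → ℝ → ℝ → ℝ) (a1 a2 a3 x y t : ℝ) :
    pdx (sh u a1 a2 a3) x y t = pdx u (x + a1) (y + a2) (t + a3) :=
  deriv_comp_add_const (fun s => u s (y + a2) (t + a3)) a1 x

lemma sh_pdy (u : ℝ → ℝ → ℝ → ℝ) (a1 a2 a3 x y t : ℝ) :
    pdy (sh u a1 a2 a3) x y t = pdy u (x + a1) (y + a2) (t + a3) :=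
  deriv_comp_add_const (fun s => u (x + a1) s (t + a3)) a2 y

lemma sh_pdt (u : ℝ → ℝ → ℝ → ℝ) (a1 a2 a3 x y t : ℝ) :
    pdt (sh u a1 a2 a3) x y t = pdt u (x + a1) (y + a2) (t + a3) :=
  deriv_comp_add_const (fun s => u (x + a1) (y + a2) s) a3 t

lemma sh_pdxx (u : ℝ → ℝ → ℝ → ℝ) (a1 a2 a3 x y t : ℝ) :
    pdxx (sh u a1 a2 a3) x y t = pdxx u (x + a1) (y + a2) (t + a3) := by
  unfold pdxx
  simp only [sh_pdx]
  exact deriv_comp_add_const (fun s => pdx u s (y + a2) (t + a3)) a1 x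

lemma sh_pdyy (u : ℝ → ℝ → ℝ → ℝ) (a1 a2 a3 x y t : ℝ) :
    pdyy (sh u a1 a2 a3) x y t = pdyy u (x + a1) (y + a2) (t + a3) := by
  unfold pdyy
  simp only [sh_pdy]
  exact deriv_comp_add_const (fun s => pdy u (x + a1) s (t + a3)) a2 y

lemma dca (f : ℝ → ℝ) (x a : ℝ) (h : DifferentiableAt ℝ f (x + a)) :
    DifferentiableAt ℝ (fun s => f (s + a)) x :=
  DifferentiableAt.comp (f := fun s => s + a) x h (by fun_prop)

lemma sh_reg (u : ℝ → ℝ → ℝ → ℝ) (a1 a2 a3 x y t : ℝ)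
    (h : C21At u (x + a1) (y + a2) (t + a3)) : Reg (sh u a1 a2 a3) x y t := by
  obtain ⟨h1, h2, h3, h4, h5, -⟩ := h
  refine ⟨dca _ _ _ h1, dca _ _ _ h2, dca _ _ _ h3, ?_, ?_⟩
  · simp only [sh_pdx]
    exact dca (fun s => pdx u s (y + a2) (t + a3)) _ _ h4
  · simp only [sh_pdy]
    exact dca (fun s => pdy u (x + a1) s (t + a3)) _ _ h5

lemma sh_cont (u : ℝ → ℝ → ℝ → ℝ) (a1 a2 a3 x y t : ℝ)
    (h : C21At u (x + a1) (y + a2) (t + a3)) :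
    ContinuousAt (fun q : ℝ × ℝ × ℝ => sh u a1 a2 a3 q.1 q.2.1 q.2.2) (x, y, t) := by
  obtain ⟨_, _, _, _, _, _, h7, -⟩ := h
  exact ContinuousAt.comp (f := fun q : ℝ × ℝ × ℝ => (q.1 + a1, q.2.1 + a2, q.2.2 + a3))
    (x := (x, y, t)) h7 (by fun_prop)

lemma shiftCP {p L T : ℝ} {u : ℝ → ℝ → ℝ → ℝ} (hL : 0 < L) (hT : 0 < T)
    (hsol : ClassicalSolution p L T u) (a1 a2 a3 b1 b2 b3 t2 c : ℝ)
    (ha1 : a1 ∈ Icc 0 (L/8)) (ha2 : a2 ∈ Icc 0 (L/8)) (ha3 : 0 ≤ a3)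
    (hb1 : b1 ∈ Icc 0 (L/8)) (hb2 : b2 ∈ Icc 0 (L/8)) (hb3 : 0 ≤ b3)
    (hta : t2 + a3 < T) (htb : t2 + b3 < T)
    (hb : ∀ x ∈ Icc (-(L/4)) (L/4), ∀ y ∈ Icc 0 (L/4), ∀ t ∈ Icc (T/2) t2,
      (x = -(L/4) ∨ x = L/4 ∨ y = 0 ∨ y = L/4 ∨ t = T/2) →
      u (x + a1) (y + a2) (t + a3) ≤ u (x + b1) (y + b2) (t + b3) + c) :
    ∀ x ∈ Icc (-(L/4)) (L/4), ∀ y ∈ Icc 0 (L/4), ∀ t ∈ Icc (T/2) t2,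
      u (x + a1) (y + a2) (t + a3) ≤ u (x + b1) (y + b2) (t + b3) + c := by
  have key : ∀ a1 a2 a3 : ℝ, a1 ∈ Icc 0 (L/8) → a2 ∈ Icc 0 (L/8) → 0 ≤ a3 → t2 + a3 < T →
      ∀ x ∈ Icc (-(L/4)) (L/4), ∀ y ∈ Icc 0 (L/4), ∀ t ∈ Icc (T/2) t2,
      |x + a1| < L ∧ y + a2 ∈ Ico 0 L ∧ t + a3 ∈ Ioo 0 T := by
    intro a1 a2 a3 h1 h2 h3 h4 x hx y hy t ht
    obtain ⟨_, _⟩ := h1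
    obtain ⟨_, _⟩ := h2
    obtain ⟨_, _⟩ := hx
    obtain ⟨_, _⟩ := hy
    obtain ⟨_, _⟩ := ht
    refine ⟨abs_lt.2 ⟨by linarith, by linarith⟩, ⟨by linarith, by linarith⟩,
      ⟨by linarith, by linarith⟩⟩
  have keyC : ∀ a1 a2 a3 : ℝ, a1 ∈ Icc 0 (L/8) → a2 ∈ Icc 0 (L/8) → 0 ≤ a3 → t2 + a3 < T →
      ∀ x ∈ Icc (-(L/4)) (L/4), ∀ y ∈ Icc 0 (L/4), ∀ t ∈ Icc (T/2) t2,
      C21At u (x + a1) (y + a2) (t + a3) := by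
    intro a1 a2 a3 h1 h2 h3 h4 x hx y hy t ht
    obtain ⟨k1, k2, k3⟩ := key a1 a2 a3 h1 h2 h3 h4 x hx y hy t ht
    exact hsol.smooth k1.le (Ico_subset_Icc_self k2) k3
  have keyP : ∀ a1 a2 a3 : ℝ, a1 ∈ Icc 0 (L/8) → a2 ∈ Icc 0 (L/8) → 0 ≤ a3 → t2 + a3 < T →
      ∀ x ∈ Ioo (-(L/4)) (L/4), ∀ y ∈ Ioo 0 (L/4), ∀ t ∈ Ioc (T/2) t2,
      pdt (sh u a1 a2 a3) x y t - (pdxx (sh u a1 a2 a3) x y t + pdyy (sh u a1 a2 a3) x y t)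
      = (Real.sqrt ((pdx (sh u a1 a2 a3) x y t) ^ 2 + (pdy (sh u a1 a2 a3) x y t) ^ 2)) ^ p := by
    intro a1 a2 a3 h1 h2 h3 h4 x hx y hy t ht
    obtain ⟨k1, k2, k3⟩ := key a1 a2 a3 h1 h2 h3 h4 x (Ioo_subset_Icc_self hx) y
      (Ioo_subset_Icc_self hy) t (Ioc_subset_Icc_self ht)
    rw [sh_pdt, sh_pdxx, sh_pdyy, sh_pdx, sh_pdy]
    exact hsol.pde k1 ⟨by linarith [hy.1, h2.1], k2.2⟩ k3
  refine CP (fun a b => (Real.sqrt (a ^ 2 + b ^ 2)) ^ p) (sh u a1 a2 a3) (sh u b1 b2 b3)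
    (L/4) (L/4) (T/2) t2 c ?_ ?_ ?_ ?_ ?_ ?_ hb
  · rintro ⟨x, y, t⟩ ⟨hx, hy, ht⟩
    exact (sh_cont u a1 a2 a3 x y t
      (keyC a1 a2 a3 ha1 ha2 ha3 hta x hx y hy t ht)).continuousWithinAt
  · rintro ⟨x, y, t⟩ ⟨hx, hy, ht⟩
    exact (sh_cont u b1 b2 b3 x y t
      (keyC b1 b2 b3 hb1 hb2 hb3 htb x hx y hy t ht)).continuousWithinAt
  · intro x hx y hy t ht
    exact sh_reg u a1 a2 a3 x y t (keyC a1 a2 a3 ha1 ha2 ha3 hta x (Ioo_subset_Icc_self hx) y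
      (Ioo_subset_Icc_self hy) t (Ioc_subset_Icc_self ht))
  · intro x hx y hy t ht
    exact sh_reg u b1 b2 b3 x y t (keyC b1 b2 b3 hb1 hb2 hb3 htb x (Ioo_subset_Icc_self hx) y
      (Ioo_subset_Icc_self hy) t (Ioc_subset_Icc_self ht))
  · intro x hx y hy t ht
    exact (keyP a1 a2 a3 ha1 ha2 ha3 hta x hx y hy t ht).le
  · intro x hx y hy t ht
    exact (keyP b1 b2 b3 hb1 hb2 hb3 htb x hx y hy t ht).ge

lemma mvt_abs (f : ℝ → ℝ) (x h K : ℝ) (hh : 0 ≤ h)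
    (hf : ∀ s ∈ Icc x (x + h), DifferentiableAt ℝ f s ∧ |deriv f s| ≤ K) :
    |f (x + h) - f x| ≤ K * h := by
  have := Convex.norm_image_sub_le_of_norm_deriv_le (f := f) (C := K) (s := Icc x (x + h))
    (x := x) (y := x + h) (fun s hs => (hf s hs).1) (fun s hs => (hf s hs).2) (convex_Icc _ _)
    ⟨le_refl _, by linarith⟩ ⟨by linarith, le_refl _⟩
  simpa [abs_of_nonneg hh] using this

lemma mvt_le (f : ℝ → ℝ) (x h K : ℝ) (hh : 0 ≤ h)
    (hf : ∀ s ∈ Icc x (x + h), DifferentiableAt ℝ f s ∧ deriv f s ≤ K) :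
    f (x + h) - f x ≤ K * h := by
  have := Convex.image_sub_le_mul_sub_of_deriv_le (f := f) (C := K) (D := Icc x (x + h))
    (convex_Icc _ _)
    (fun s hs => (hf s hs).1.continuousAt.continuousWithinAt)
    (fun s hs => (hf s (interior_subset hs)).1.differentiableWithinAt)
    (fun s hs => (hf s (interior_subset hs)).2) x
    ⟨le_refl _, by linarith⟩ (x + h) ⟨by linarith, le_refl _⟩ (by linarith)
  simpa using this

def GA (L T x y t : ℝ) : Prop :=
  |x| ≤ L/2 ∧ y ∈ Icc 0 (L/2) ∧ t ∈ Icc (T/2) T ∧ (L/8 ≤ |x| ∨ L/8 ≤ y ∨ t ≤ 3*T/4)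

lemma GA_smooth {L T : ℝ} {u : ℝ → ℝ → ℝ → ℝ} (hL : 0 < L) (hT : 0 < T)
    (hext : ExtC21 L T u) {x y t : ℝ} (h : GA L T x y t) : C21At u x y t := by
  obtain ⟨h1, h2, h3, h4⟩ := h
  refine hext h1 h2 h3 ?_
  rintro ⟨rfl, rfl, rfl⟩
  rw [abs_zero] at h4
  rcases h4 with h | h | h <;> linarith

lemma GA_bound {L T : ℝ} {u : ℝ → ℝ → ℝ → ℝ} (hL : 0 < L) (hT : 0 < T)
    (hext : ExtC21 L T u) : ∃ K, 0 ≤ K ∧ ∀ x y t, GA L T x y t →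
      |pdx u x y t| ≤ K ∧ |pdy u x y t| ≤ K ∧ |pdt u x y t| ≤ K := by
  set S : Set (ℝ × ℝ × ℝ) := {q | GA L T q.1 q.2.1 q.2.2} with hS
  have hSc : IsCompact S := by
    apply IsCompact.of_isClosed_subset
      (isCompact_Icc.prod (isCompact_Icc.prod isCompact_Icc) :
        IsCompact (Icc (-(L/2)) (L/2) ×ˢ Icc 0 (L/2) ×ˢ Icc (T/2) T))
    · simp only [hS, GA, mem_Icc, ofPred_and, ofPred_or]
      refine IsClosed.inter (isClosed_le (by fun_prop) (by fun_prop)) ?_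
      refine IsClosed.inter (IsClosed.inter (isClosed_le (by fun_prop) (by fun_prop))
        (isClosed_le (by fun_prop) (by fun_prop))) ?_
      refine IsClosed.inter (IsClosed.inter (isClosed_le (by fun_prop) (by fun_prop))
        (isClosed_le (by fun_prop) (by fun_prop))) ?_
      exact (isClosed_le (by fun_prop) (by fun_prop)).union
        ((isClosed_le (by fun_prop) (by fun_prop)).union
        (isClosed_le (by fun_prop) (by fun_prop)))
    · rintro ⟨x, y, t⟩ ⟨h1, h2, h3, -⟩
      exact ⟨abs_le.1 h1, h2, h3⟩
  have cx : ContinuousOn (fun q : ℝ × ℝ × ℝ => pdx u q.1 q.2.1 q.2.2) S := by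
    rintro ⟨x, y, t⟩ h
    obtain ⟨_, _, _, _, _, _, h7, h8, h9, h10, -⟩ := GA_smooth hL hT hext h
    exact h8.continuousWithinAt
  have cy : ContinuousOn (fun q : ℝ × ℝ × ℝ => pdy u q.1 q.2.1 q.2.2) S := by
    rintro ⟨x, y, t⟩ h
    obtain ⟨_, _, _, _, _, _, h7, h8, h9, h10, -⟩ := GA_smooth hL hT hext h
    exact h9.continuousWithinAt
  have ct : ContinuousOn (fun q : ℝ × ℝ × ℝ => pdt u q.1 q.2.1 q.2.2) S := by
    rintro ⟨x, y, t⟩ h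
    obtain ⟨_, _, _, _, _, _, h7, h8, h9, h10, -⟩ := GA_smooth hL hT hext h
    exact h10.continuousWithinAt
  obtain ⟨K1, hK1⟩ := hSc.exists_bound_of_continuousOn cx
  obtain ⟨K2, hK2⟩ := hSc.exists_bound_of_continuousOn cy
  obtain ⟨K3, hK3⟩ := hSc.exists_bound_of_continuousOn ct
  refine ⟨max 0 (max K1 (max K2 K3)), le_max_left _ _, fun x y t h => ?_⟩
  have e1 := hK1 (x, y, t) h
  have e2 := hK2 (x, y, t) h
  have e3 := hK3 (x, y, t) h
  simp only [Real.norm_eq_abs] at e1 e2 e3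
  refine ⟨?_, ?_, ?_⟩
  · exact e1.trans (by simp)
  · exact e2.trans (by simp)
  · exact e3.trans (by simp)

lemma ux_bound {p L T : ℝ} {u : ℝ → ℝ → ℝ → ℝ} (hL : 0 < L) (hT : 0 < T)
    (hsol : ClassicalSolution p L T u) (hext : ExtC21 L T u) {K : ℝ} (hK0 : 0 ≤ K)
    (hK : ∀ x y t, GA L T x y t →
      |pdx u x y t| ≤ K ∧ |pdy u x y t| ≤ K ∧ |pdt u x y t| ≤ K)
    {x y t : ℝ} (hx : x ∈ Icc (-(L/4)) (L/4)) (hy : y ∈ Icc 0 (L/4)) (ht : t ∈ Ico (T/2) T) :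
    |pdx u x y t| ≤ K := by
  have hbd : ∀ h ∈ Icc 0 (L/8), ∀ x ∈ Icc (-(L/4)) (L/4), ∀ y ∈ Icc 0 (L/4),
      ∀ s ∈ Icc (T/2) t, (x = -(L/4) ∨ x = L/4 ∨ y = 0 ∨ y = L/4 ∨ s = T/2) →
      |u (x + h) y s - u x y s| ≤ K * h := by
    intro h hh x hx y hy s hs hor
    obtain ⟨hh1, hh2⟩ := hh
    obtain ⟨hx1, hx2⟩ := hx
    obtain ⟨hy1, hy2⟩ := hy
    obtain ⟨hs1, hs2⟩ := hs
    have hsT : s < T := by linarith [ht.2]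
    have done : (∀ r ∈ Icc x (x + h), L/8 ≤ |r| ∨ L/8 ≤ y ∨ s ≤ 3*T/4) →
        |u (x + h) y s - u x y s| ≤ K * h := by
      intro hr
      refine mvt_abs (fun r => u r y s) x h K hh1 (fun r hr' => ?_)
      have g : GA L T r y s := ⟨abs_le.2 ⟨by linarith [hr'.1], by linarith [hr'.2]⟩,
        ⟨hy1, by linarith⟩, ⟨hs1, hsT.le⟩, hr r hr'⟩
      exact ⟨(GA_smooth hL hT hext g).1, (hK _ _ _ g).1⟩
    rcases hor with e | e | e | e | e
    · refine done fun r hr => Or.inl ?_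
      rw [le_abs]; right; linarith [hr.2]
    · refine done fun r hr => Or.inl ?_
      rw [le_abs]; left; linarith [hr.1]
    · subst e
      rw [hsol.bc (abs_lt.2 ⟨by linarith, by linarith⟩) ⟨by linarith, hsT⟩,
        hsol.bc (abs_lt.2 ⟨by linarith, by linarith⟩) ⟨by linarith, hsT⟩]
      simp only [sub_zero, abs_zero]; positivity
    · exact done fun r hr => Or.inr (Or.inl (by linarith))
    · exact done fun r hr => Or.inr (Or.inr (by linarith))
  have h0 : (0:ℝ) ∈ Icc 0 (L/8) := ⟨le_refl _, by linarith⟩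
  have hd : DifferentiableAt ℝ (fun r => u r y t) x :=
    (hsol.smooth (abs_le.2 ⟨by linarith [hx.1], by linarith [hx.2]⟩) ⟨hy.1, by linarith [hy.2]⟩
      ⟨by linarith [ht.1], ht.2⟩).1
  rw [abs_le]
  constructor
  · refine D1right' (fun r => u r y t) x K (L/8) (by linarith) hd (fun h h1 h2 => ?_)
    have := shiftCP hL hT hsol 0 0 0 h 0 0 t (K * h) h0 h0 le_rfl ⟨h1.le, h2.le⟩ h0 le_rfl
      (by linarith [ht.2]) (by linarith [ht.2]) (fun x hx y hy s hs hor => by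
        have := (abs_le.1 (hbd h ⟨h1.le, h2.le⟩ x hx y hy s hs hor)).1
        simp only [add_zero]; linarith) x hx y hy t ⟨ht.1, le_rfl⟩
    simp only [add_zero] at this
    linarith
  · refine D1right (fun r => u r y t) x K (L/8) (by linarith) hd (fun h h1 h2 => ?_)
    have := shiftCP hL hT hsol h 0 0 0 0 0 t (K * h) ⟨h1.le, h2.le⟩ h0 le_rfl h0 h0 le_rfl
      (by linarith [ht.2]) (by linarith [ht.2]) (fun x hx y hy s hs hor => by
        have := (abs_le.1 (hbd h ⟨h1.le, h2.le⟩ x hx y hy s hs hor)).2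
        simp only [add_zero]; linarith) x hx y hy t ⟨ht.1, le_rfl⟩
    simp only [add_zero] at this
    linarith

/-- side bounds for `y` differences, away from `y=0` -/
lemma uy_side {L T : ℝ} {u : ℝ → ℝ → ℝ → ℝ} (hL : 0 < L) (hT : 0 < T)
    (hext : ExtC21 L T u) {K : ℝ}
    (hK : ∀ x y t, GA L T x y t →
      |pdx u x y t| ≤ K ∧ |pdy u x y t| ≤ K ∧ |pdt u x y t| ≤ K)
    {t : ℝ} (ht : t ∈ Ico (T/2) T) : ∀ h ∈ Icc 0 (L/8), ∀ x ∈ Icc (-(L/4)) (L/4),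
      ∀ y ∈ Icc 0 (L/4),
      ∀ s ∈ Icc (T/2) t, (x = -(L/4) ∨ x = L/4 ∨ y = L/4 ∨ s = T/2) →
      |u x (y + h) s - u x y s| ≤ K * h := by
  intro h hh x hx y hy s hs hor
  obtain ⟨hh1, hh2⟩ := hh
  obtain ⟨hx1, hx2⟩ := hx
  obtain ⟨hy1, hy2⟩ := hy
  obtain ⟨hs1, hs2⟩ := hs
  have hsT : s < T := by linarith [ht.2]
  refine mvt_abs (fun r => u x r s) y h K hh1 (fun r hr' => ?_)
  have g : GA L T x r s := by
    refine ⟨abs_le.2 ⟨by linarith, by linarith⟩,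
      ⟨by linarith [hr'.1], by linarith [hr'.2]⟩, ⟨hs1, hsT.le⟩, ?_⟩
    rcases hor with e | e | e | e
    · left; rw [le_abs]; right; linarith
    · left; rw [le_abs]; left; linarith
    · right; left; linarith [hr'.1]
    · right; right; linarith
  exact ⟨(GA_smooth hL hT hext g).2.1, (hK _ _ _ g).2.1⟩

lemma uy_lower {p L T : ℝ} {u : ℝ → ℝ → ℝ → ℝ} (hL : 0 < L) (hT : 0 < T)
    (hsol : ClassicalSolution p L T u) (hext : ExtC21 L T u) {K : ℝ} (hK0 : 0 ≤ K)
    (hK : ∀ x y t, GA L T x y t →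
      |pdx u x y t| ≤ K ∧ |pdy u x y t| ≤ K ∧ |pdt u x y t| ≤ K)
    {x y t : ℝ} (hx : x ∈ Icc (-(L/4)) (L/4)) (hy : y ∈ Icc 0 (L/4)) (ht : t ∈ Ico (T/2) T) :
    -K ≤ pdy u x y t := by
  have h0 : (0:ℝ) ∈ Icc 0 (L/8) := ⟨le_refl _, by linarith⟩
  have hd : DifferentiableAt ℝ (fun r => u x r t) y :=
    (hsol.smooth (abs_le.2 ⟨by linarith [hx.1], by linarith [hx.2]⟩) ⟨hy.1, by linarith [hy.2]⟩
      ⟨by linarith [ht.1], ht.2⟩).2.1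
  refine D1right' (fun r => u x r t) y K (L/8) (by linarith) hd (fun h h1 h2 => ?_)
  have := shiftCP hL hT hsol 0 0 0 0 h 0 t (K * h) h0 h0 le_rfl h0 ⟨h1.le, h2.le⟩ le_rfl
      (by linarith [ht.2]) (by linarith [ht.2]) (fun x hx y hy s hs hor => by
        have hs' := uy_side hL hT hext hK ht h ⟨h1.le, h2.le⟩ x hx y hy s hs
        simp only [add_zero]
        rcases eq_or_ne y 0 with e | e
        · subst e
          have hx' : |x| < L := abs_lt.2 ⟨by linarith [hx.1], by linarith [hx.2]⟩
          have hst : s ∈ Ioo 0 T := ⟨by linarith [hs.1], by linarith [hs.2, ht.2]⟩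
          rw [hsol.bc hx' hst]
          have := hsol.nonneg (x := x) (y := 0 + h) (t := s) hx'.le
            ⟨by linarith, by linarith⟩ hst
          have : 0 ≤ K * h := by positivity
          linarith
        · have := (abs_le.1 (hs' (by tauto))).1
          linarith) x hx y hy t ⟨ht.1, le_rfl⟩
  simp only [add_zero] at this
  linarith

lemma ut_lower {p L T : ℝ} {u : ℝ → ℝ → ℝ → ℝ} (hL : 0 < L) (hT : 0 < T)
    (hsol : ClassicalSolution p L T u) (hext : ExtC21 L T u) {K : ℝ} (hK0 : 0 ≤ K)
    (hK : ∀ x y t, GA L T x y t →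
      |pdx u x y t| ≤ K ∧ |pdy u x y t| ≤ K ∧ |pdt u x y t| ≤ K)
    {x y t : ℝ} (hx : x ∈ Icc (-(L/4)) (L/4)) (hy : y ∈ Icc 0 (L/4)) (ht : t ∈ Ico (T/2) T) :
    -K ≤ pdt u x y t := by
  have h0 : (0:ℝ) ∈ Icc 0 (L/8) := ⟨le_refl _, by linarith⟩
  have hd : DifferentiableAt ℝ (fun r => u x y r) t :=
    (hsol.smooth (abs_le.2 ⟨by linarith [hx.1], by linarith [hx.2]⟩) ⟨hy.1, by linarith [hy.2]⟩
      ⟨by linarith [ht.1], ht.2⟩).2.2.1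
  refine D1right' (fun r => u x y r) t K (min (T/4) (T - t))
    (lt_min (by linarith) (by linarith [ht.2])) hd (fun h h1 h2 => ?_)
  have h3 : h < T/4 := h2.trans_le (min_le_left _ _)
  have h4 : h < T - t := h2.trans_le (min_le_right _ _)
  have := shiftCP hL hT hsol 0 0 0 0 0 h t (K * h) h0 h0 le_rfl h0 h0 h1.le
      (by linarith [ht.2]) (by linarith) (fun x hx y hy s hs hor => by
        simp only [add_zero]
        have hx' : |x| < L := abs_lt.2 ⟨by linarith [hx.1], by linarith [hx.2]⟩
        rcases eq_or_ne y 0 with e | e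
        · subst e
          rw [hsol.bc hx' ⟨by linarith [hs.1], by linarith [hs.2, ht.2]⟩,
            hsol.bc hx' ⟨by linarith [hs.1], by linarith [hs.2, ht.2]⟩]
          have : 0 ≤ K * h := by positivity
          linarith
        · have := mvt_abs (fun r => u x y r) s h K h1.le (fun r hr => by
            have g : GA L T x y r := by
              refine ⟨abs_le.2 ⟨by linarith [hx.1], by linarith [hx.2]⟩,
                ⟨hy.1, by linarith [hy.2]⟩,
                ⟨by linarith [hr.1, hs.1], by linarith [hr.2, hs.2]⟩, ?_⟩
              rcases hor with e' | e' | e' | e' | e'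
              · left; rw [le_abs]; right; linarith
              · left; rw [le_abs]; left; linarith
              · exact absurd e' e
              · right; left; linarith
              · right; right; linarith [hr.2]
            exact ⟨(GA_smooth hL hT hext g).2.2.1, (hK _ _ _ g).2.2⟩)
          have := (abs_le.1 this).1
          linarith) x hx y hy t ⟨ht.1, le_rfl⟩
  simp only [add_zero] at this
  linarith

lemma u_mono {p L T : ℝ} {u : ℝ → ℝ → ℝ → ℝ} (hL : 0 < L)
    (hsol : ClassicalSolution p L T u) (hmon : MonCond L T u)
    {x y t : ℝ} (hx : |x| < L) (hy : y ∈ Ico 0 L) (ht : t ∈ Ioo 0 T) :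
    u x y t ≤ u 0 y t := by
  rcases eq_or_lt_of_le hy.1 with e | e
  · subst e
    rw [hsol.bc hx ht, hsol.bc (by simpa using hL) ht]
  have hy' : y ∈ Ioo 0 L := ⟨e, hy.2⟩
  have hd : ∀ r, |r| < L → DifferentiableAt ℝ (fun r => u r y t) r := fun r hr =>
    (hsol.smooth hr.le ⟨hy.1, hy.2.le⟩ ht).1
  rw [abs_lt] at hx
  rcases le_total 0 x with h | h
  · have : AntitoneOn (fun r => u r y t) (Icc 0 x) := by
      apply antitoneOn_of_deriv_nonpos (convex_Icc _ _)
      · intro r hr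
        exact (hd r (abs_lt.2 ⟨by linarith [hr.1], by linarith [hr.2]⟩)).continuousAt.continuousWithinAt
      · intro r hr
        have hr := interior_subset hr
        exact (hd r (abs_lt.2 ⟨by linarith [hr.1], by linarith [hr.2]⟩)).differentiableWithinAt
      · intro r hr
        rw [interior_Icc] at hr
        have := hmon (x := r) (abs_lt.2 ⟨by linarith [hr.1], by linarith [hr.2]⟩) hy' ht
        change pdx u r y t ≤ 0
        by_contra! hc
        have := mul_pos hr.1 hc
        linarith
    exact this ⟨le_rfl, h⟩ ⟨h, le_rfl⟩ h
  · have : MonotoneOn (fun r => u r y t) (Icc x 0) := by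
      apply monotoneOn_of_deriv_nonneg (convex_Icc _ _)
      · intro r hr
        exact (hd r (abs_lt.2 ⟨by linarith [hr.1], by linarith [hr.2]⟩)).continuousAt.continuousWithinAt
      · intro r hr
        have hr := interior_subset hr
        exact (hd r (abs_lt.2 ⟨by linarith [hr.1], by linarith [hr.2]⟩)).differentiableWithinAt
      · intro r hr
        rw [interior_Icc] at hr
        have := hmon (x := r) (abs_lt.2 ⟨by linarith [hr.1], by linarith [hr.2]⟩) hy' ht
        change 0 ≤ pdx u r y t
        by_contra! hc
        have := mul_pos_of_neg_of_neg hr.2 hc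
        linarith
    exact this ⟨le_rfl, h⟩ ⟨h, le_rfl⟩ h

lemma uy_upper {p L T : ℝ} {u : ℝ → ℝ → ℝ → ℝ} (hL : 0 < L) (hT : 0 < T)
    (hsol : ClassicalSolution p L T u) (hext : ExtC21 L T u) (hmon : MonCond L T u)
    {K M : ℝ} (hKM : M + 1 ≤ K)
    (hK : ∀ x y t, GA L T x y t →
      |pdx u x y t| ≤ K ∧ |pdy u x y t| ≤ K ∧ |pdt u x y t| ≤ K)
    (hM : ∀ t ∈ Ico (T/2) T, pdy u 0 0 t ≤ M)
    {x y t : ℝ} (hx : x ∈ Icc (-(L/4)) (L/4)) (hy : y ∈ Icc 0 (L/4)) (ht : t ∈ Ico (T/2) T) :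
    pdy u x y t ≤ K := by
  have h0 : (0:ℝ) ∈ Icc 0 (L/8) := ⟨le_refl _, by linarith⟩
  have h00 : |(0:ℝ)| < L := by simpa using hL
  have hd : DifferentiableAt ℝ (fun r => u x r t) y :=
    (hsol.smooth (abs_le.2 ⟨by linarith [hx.1], by linarith [hx.2]⟩) ⟨hy.1, by linarith [hy.2]⟩
      ⟨by linarith [ht.1], ht.2⟩).2.1
  obtain ⟨d, hd0, hdd⟩ : ∃ d > 0, ∀ s ∈ Icc (T/2) t, ∀ y ∈ Icc 0 (L/4), y < d →
      pdy u 0 y s ≤ M + 1 := by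
    have hc : ContinuousOn (fun q : ℝ × ℝ => pdy u 0 q.1 q.2) (Icc 0 (L/4) ×ˢ Icc (T/2) t) := by
      rintro ⟨y, s⟩ ⟨hy, hs⟩
      obtain ⟨_, _, _, _, _, _, _, _, h9, -⟩ := hsol.smooth (x := 0) (y := y) (t := s) h00.le
        ⟨hy.1, by linarith [hy.2]⟩ ⟨by linarith [hs.1], by linarith [hs.2, ht.2]⟩
      exact (ContinuousAt.comp (f := fun q : ℝ × ℝ => ((0:ℝ), q.1, q.2))
        (x := (y, s)) h9 (by fun_prop)).continuousWithinAt
    have huc := (isCompact_Icc.prod isCompact_Icc).uniformContinuousOn_of_continuous hc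
    rw [Metric.uniformContinuousOn_iff] at huc
    obtain ⟨d, hd0, hdd⟩ := huc 1 one_pos
    refine ⟨d, hd0, fun s hs y hy hyd => ?_⟩
    have h := hdd (y, s) ⟨hy, hs⟩ (0, s) ⟨⟨le_rfl, by linarith⟩, hs⟩ (by
      simp [Prod.dist_eq, abs_of_nonneg hy.1, hyd, hd0])
    rw [Real.dist_eq] at h
    have := (abs_lt.1 h).2
    have := hM s ⟨hs.1, by linarith [hs.2, ht.2]⟩
    simp only at *
    linarith
  refine D1right (fun r => u x r t) y K (min d (L/8)) (lt_min hd0 (by linarith)) hd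
    (fun h h1 h2 => ?_)
  have h3 : h < d := h2.trans_le (min_le_left _ _)
  have h4 : h < L/8 := h2.trans_le (min_le_right _ _)
  have := shiftCP hL hT hsol 0 h 0 0 0 0 t (K * h) h0 ⟨h1.le, h4.le⟩ le_rfl h0 h0 le_rfl
      (by linarith [ht.2]) (by linarith [ht.2]) (fun x hx y hy s hs hor => by
        have hs' := uy_side hL hT hext hK ht h ⟨h1.le, h4.le⟩ x hx y hy s hs
        simp only [add_zero]
        rcases eq_or_ne y 0 with e | e
        · subst e
          have hx' : |x| < L := abs_lt.2 ⟨by linarith [hx.1], by linarith [hx.2]⟩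
          have hst : s ∈ Ioo 0 T := ⟨by linarith [hs.1], by linarith [hs.2, ht.2]⟩
          rw [hsol.bc hx' hst]
          have m1 := u_mono (y := 0 + h) hL hsol hmon hx' ⟨by linarith, by linarith⟩ hst
          have m2 := mvt_le (fun r => u 0 r s) 0 h (M + 1) h1.le (fun r hr =>
            ⟨(hsol.smooth h00.le ⟨hr.1, by linarith [hr.2]⟩ hst).2.1,
              hdd s hs r ⟨hr.1, by linarith [hr.2]⟩ (by linarith [hr.2])⟩)
          rw [hsol.bc h00 hst] at m2
          have : (M + 1) * h ≤ K * h := mul_le_mul_of_nonneg_right hKM h1.le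
          linarith
        · have := (abs_le.1 (hs' (by tauto))).2
          linarith) x hx y hy t ⟨ht.1, le_rfl⟩
  simp only [add_zero] at this
  linarith

lemma uy_unbdd {p L T : ℝ} {u : ℝ → ℝ → ℝ → ℝ} (hL : 0 < L) (hT : 0 < T)
    (hsol : ClassicalSolution p L T u) (hgbu : IsolatedGBU L T u)
    (hext : ExtC21 L T u) (hmon : MonCond L T u) (M δ : ℝ) (hδ : 0 < δ) :
    ∃ t, t ∈ Ico (T/2) T ∧ T - δ < t ∧ M < pdy u 0 0 t := by
  by_contra! hcon
  have h00 : |(0:ℝ)| < L := by simpa using hL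
  obtain ⟨M', hM'⟩ : ∃ M', ∀ t ∈ Ico (T/2) T, pdy u 0 0 t ≤ M' := by
    have hc : ContinuousOn (fun s => pdy u 0 0 s) (Icc (T/2) (T - δ)) := by
      intro s hs
      obtain ⟨_, _, _, _, _, _, _, _, h9, -⟩ := hsol.smooth (x := 0) (y := 0) (t := s) h00.le
        ⟨le_rfl, hL.le⟩ ⟨by linarith [hs.1], by linarith [hs.2]⟩
      exact (ContinuousAt.comp (f := fun q : ℝ => ((0:ℝ), (0:ℝ), q))
        (x := s) h9 (by fun_prop)).continuousWithinAt
    obtain ⟨M2, hM2⟩ := isCompact_Icc.exists_bound_of_continuousOn hc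
    refine ⟨max M M2, fun t ht => ?_⟩
    rcases lt_or_ge (T - δ) t with h | h
    · exact (hcon t ht h).trans (le_max_left _ _)
    · exact ((le_abs_self _).trans (hM2 t ⟨ht.1, h⟩)).trans (le_max_right _ _)
  obtain ⟨K0, hK0, hK⟩ := GA_bound hL hT hext
  set K := max K0 (M' + 1) with hKdef
  have hKK : 0 ≤ K := hK0.trans (le_max_left _ _)
  have hK' : ∀ x y t, GA L T x y t →
      |pdx u x y t| ≤ K ∧ |pdy u x y t| ≤ K ∧ |pdt u x y t| ≤ K := fun x y t g =>
    ⟨(hK x y t g).1.trans (le_max_left _ _), (hK x y t g).2.1.trans (le_max_left _ _),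
      (hK x y t g).2.2.trans (le_max_left _ _)⟩
  obtain ⟨x, y, t, -, hy, ht, hxd, hyd, htd, hg⟩ := hgbu.blowup (K + K) (min (L/4) (T/2))
    (lt_min (by linarith) (by linarith))
  have hxd := abs_lt.1 (hxd.trans_le (min_le_left _ _))
  have hyd := abs_lt.1 (hyd.trans_le (min_le_left _ _))
  have htd' := min_le_right (L/4) (T/2)
  have Hx : x ∈ Icc (-(L/4)) (L/4) := ⟨hxd.1.le, hxd.2.le⟩
  have Hy : y ∈ Icc 0 (L/4) := ⟨hy.1, hyd.2.le⟩
  have Ht : t ∈ Ico (T/2) T := ⟨by linarith, ht.2⟩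
  have b1 := ux_bound hL hT hsol hext hKK hK' Hx Hy Ht
  have b2 := uy_lower hL hT hsol hext hKK hK' Hx Hy Ht
  have b3 := uy_upper hL hT hsol hext hmon (le_max_right _ _) hK' hM' Hx Hy Ht
  have : gradNorm u x y t ≤ K + K := by
    unfold gradNorm
    apply Real.sqrt_le_iff.2
    refine ⟨by linarith, ?_⟩
    have := abs_le.1 b1
    nlinarith [sq_le_sq' this.1 this.2, sq_le_sq' b2 b3]
  linarith

lemma line_ineq {p L T : ℝ} {u : ℝ → ℝ → ℝ → ℝ} (hp : 2 < p) (hL : 0 < L) (hT : 0 < T)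
    (hsol : ClassicalSolution p L T u) (hext : ExtC21 L T u) (hmon : MonCond L T u)
    {K : ℝ} (hK0 : 0 ≤ K)
    (hK : ∀ x y t, GA L T x y t →
      |pdx u x y t| ≤ K ∧ |pdy u x y t| ≤ K ∧ |pdt u x y t| ≤ K)
    {t : ℝ} (ht : t ∈ Ico (T/2) T) : ∀ y ∈ Ico 0 (L/4),
    -K - |pdy u 0 y t| ^ p ≤ pdyy u 0 y t := by
  have h00 : |(0:ℝ)| < L := by simpa using hL
  have ht' : t ∈ Ioo 0 T := ⟨by linarith [ht.1], ht.2⟩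
  have main : ∀ y ∈ Ioo 0 (L/4), -K - |pdy u 0 y t| ^ p ≤ pdyy u 0 y t := by
    intro y hy
    have hyL : y ∈ Ioo 0 L := ⟨hy.1, by linarith [hy.2]⟩
    have hmax : IsLocalMax (fun s => u s y t) 0 := by
      filter_upwards [Ioo_mem_nhds (show -L < 0 by linarith) hL] with s hs
      exact u_mono hL hsol hmon (abs_lt.2 hs) ⟨hyL.1.le, hyL.2⟩ ht'
    have hsm := hsol.smooth h00.le ⟨hyL.1.le, hyL.2.le⟩ ht'
    have e1 : pdx u 0 y t = 0 := hmax.deriv_eq_zero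
    have e2 : pdxx u 0 y t ≤ 0 := D2aux _ _ hsm.1.continuousAt hmax
    have e3 := ut_lower (x := 0) hL hT hsol hext hK0 hK ⟨by linarith, by linarith⟩
      ⟨hy.1.le, hy.2.le⟩ ht
    have e4 := hsol.pde h00 hyL ht'
    have e5 : gradNorm u 0 y t = |pdy u 0 y t| := by
      unfold gradNorm
      rw [e1]
      simp [Real.sqrt_sq_eq_abs]
    rw [e5] at e4
    linarith
  intro y hy
  rcases eq_or_lt_of_le hy.1 with e | e
  · subst e
    obtain ⟨_, _, _, _, _, _, _, _, h9, _, _, h12, _⟩ :=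
      hsol.smooth (x := 0) (y := 0) (t := t) h00.le ⟨le_rfl, hL.le⟩ ht'
    have c1 : ContinuousAt (fun s => pdy u 0 s t) 0 :=
      ContinuousAt.comp (f := fun s : ℝ => ((0:ℝ), s, t)) (x := 0) h9 (by fun_prop)
    have c2 : ContinuousAt (fun s => pdyy u 0 s t) 0 :=
      ContinuousAt.comp (f := fun s : ℝ => ((0:ℝ), s, t)) (x := 0) h12 (by fun_prop)
    have c3 : ContinuousAt (fun s => -K - |pdy u 0 s t| ^ p) 0 :=
      continuousAt_const.sub (c1.abs.rpow_const (Or.inr (by linarith)))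
    have l2 : Tendsto (fun s => pdyy u 0 s t) (nhdsWithin 0 (Ioi 0)) (nhds (pdyy u 0 0 t)) :=
      c2.tendsto.mono_left nhdsWithin_le_nhds
    have l3 : Tendsto (fun s => -K - |pdy u 0 s t| ^ p) (nhdsWithin 0 (Ioi 0))
        (nhds (-K - |pdy u 0 0 t| ^ p)) := c3.tendsto.mono_left nhdsWithin_le_nhds
    refine le_of_tendsto_of_tendsto l3 l2 ?_
    filter_upwards [Ioo_mem_nhdsGT (show (0:ℝ) < L/4 by linarith)] with s hs using main s hs
  · exact main y ⟨e, hy.2⟩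

lemma est_i {p L T : ℝ} {u : ℝ → ℝ → ℝ → ℝ} (hp : 2 < p) (hL : 0 < L) (hT : 0 < T)
    (hsol : ClassicalSolution p L T u) (hext : ExtC21 L T u) (hmon : MonCond L T u)
    {K : ℝ} (hK0 : 0 ≤ K)
    (hK : ∀ x y t, GA L T x y t →
      |pdx u x y t| ≤ K ∧ |pdy u x y t| ≤ K ∧ |pdt u x y t| ≤ K)
    {b : ℝ} (hbL : b ≤ L/4) (hKb : (K + 2) * b ≤ 1)
    {t : ℝ} (ht : t ∈ Ico (T/2) T) (hpos : 0 < pdy u 0 0 t) : ∀ y ∈ Icc 0 b,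
    ((pdy u 0 0 t) ^ (1 - p) + (p - 1) * y) ^ (-(1/(p-1))) - (K + 2) * y ≤ pdy u 0 y t := by
  have h00 : |(0:ℝ)| < L := by simpa using hL
  have ht' : t ∈ Ioo 0 T := ⟨by linarith [ht.1], ht.2⟩
  refine ode_cmp p K b hp hK0 hKb (fun y => pdy u 0 y t) (fun y => pdyy u 0 y t) ?_ ?_ hpos
  · intro y hy
    exact (hsol.smooth h00.le ⟨hy.1, by linarith [hy.2]⟩ ht').2.2.2.2.1.hasDerivAt
  · intro y hy
    exact line_ineq hp hL hT hsol hext hmon hK0 hK ht y ⟨hy.1, hy.2.trans_le hbL⟩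

lemma est_iii {p L T : ℝ} {u : ℝ → ℝ → ℝ → ℝ} (hp : 2 < p) (hL : 0 < L) (hT : 0 < T)
    (hsol : ClassicalSolution p L T u) (hext : ExtC21 L T u) (hmon : MonCond L T u)
    {K : ℝ} (hK0 : 0 ≤ K)
    (hK : ∀ x y t, GA L T x y t →
      |pdx u x y t| ≤ K ∧ |pdy u x y t| ≤ K ∧ |pdt u x y t| ≤ K)
    {b : ℝ} (hbL : b ≤ L/4) (hKb : (K + 2) * b ≤ 1)
    {t : ℝ} (ht : t ∈ Ico (T/2) T) (hpos : 0 < pdy u 0 0 t) : ∀ y ∈ Icc 0 b,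
    (((pdy u 0 0 t) ^ (1 - p) + (p - 1) * y) ^ (1 - 1/(p-1))
      - ((pdy u 0 0 t) ^ (1 - p)) ^ (1 - 1/(p-1))) / (p - 2) - (K + 2) * y ≤ u 0 y t := by
  intro y hy
  have h00 : |(0:ℝ)| < L := by simpa using hL
  have ht' : t ∈ Ioo 0 T := ⟨by linarith [ht.1], ht.2⟩
  have hp1 : 0 < p - 1 := by linarith
  have hp2 : 0 < p - 2 := by linarith
  have hm : 0 < (pdy u 0 0 t) ^ (1 - p) := Real.rpow_pos_of_pos hpos _
  set m := (pdy u 0 0 t) ^ (1 - p) with hmdef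
  have hder : ∀ r ∈ Icc 0 b, HasDerivAt (fun r => (m + (p - 1) * r) ^ (1 - 1/(p-1)) / (p - 2)
      - (K + 2) * r - u 0 r t) ((m + (p - 1) * r) ^ (-(1/(p-1))) - (K + 2) - pdy u 0 r t) r := by
    intro r hr
    have h1 : HasDerivAt (fun y => m + (p - 1) * y) (p - 1) r := by
      simpa using ((hasDerivAt_id r).const_mul (p - 1)).const_add m
    have hb : 0 < m + (p - 1) * r := by have := mul_nonneg hp1.le hr.1; linarith
    have h2 := (h1.rpow_const (p := 1 - 1/(p-1)) (Or.inl hb.ne')).div_const (p - 2)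
    have h3 : HasDerivAt (fun r => (K + 2) * r) (K + 2) r := by
      simpa using (hasDerivAt_id r).const_mul (K + 2)
    have h4 : HasDerivAt (fun r => u 0 r t) (pdy u 0 r t) r :=
      (hsol.smooth h00.le ⟨hr.1, by linarith [hr.2]⟩ ht').2.1.hasDerivAt
    have h5 := (h2.sub h3).sub h4
    have e : (p - 1) * (1 - 1 / (p - 1)) * (m + (p - 1) * r) ^ (1 - 1 / (p - 1) - 1) / (p - 2)
        = (m + (p - 1) * r) ^ (-(1/(p-1))) := by
      have e1 : 1 - 1 / (p - 1) - 1 = -(1/(p-1)) := by ring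
      have e2 : (p - 1) * (1 - 1 / (p - 1)) = p - 2 := by field_simp; ring
      rw [e1, e2]
      field_simp
    rw [e] at h5
    exact h5
  have hle := mvt_le (fun r => (m + (p - 1) * r) ^ (1 - 1/(p-1)) / (p - 2)
      - (K + 2) * r - u 0 r t) 0 y 0 hy.1 (fun r hr => by
    have hr' : r ∈ Icc 0 b := ⟨hr.1, by linarith [hr.2, hy.2]⟩
    have hd := hder r hr'
    refine ⟨hd.differentiableAt, ?_⟩
    rw [hd.deriv]
    have h1 := est_i hp hL hT hsol hext hmon hK0 hK hbL hKb ht hpos r hr'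
    have h2 : (K + 2) * r ≤ 1 := le_trans (mul_le_mul_of_nonneg_left hr'.2 (by linarith)) hKb
    linarith)
  simp only [zero_add, mul_zero, add_zero, zero_mul, sub_zero] at hle
  rw [hsol.bc h00 ht'] at hle
  rw [sub_div]
  linarith

lemma hopf {p L T : ℝ} {u : ℝ → ℝ → ℝ → ℝ} (hL : 0 < L)
    (hsol : ClassicalSolution p L T u) (a b t1 t2 c : ℝ) (ha : 0 < a) (haL : a < L)
    (hb : 0 < b) (hbL : b < L) (ht1 : 0 < t1) (ht12 : t1 < t2) (ht2 : t2 < T) (hc : 0 < c)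
    (hu : ∀ x ∈ Icc (-a) a, ∀ t ∈ Icc t1 t2, c ≤ u x b t) : 0 < pdy u 0 0 t2 := by
  set A := b / a ^ 2 with hA
  set B := b / (t2 - t1) with hB
  set k := B + 2 * A with hk
  have hApos : 0 < A := by positivity
  have hBpos : 0 < B := div_pos hb (by linarith)
  have hkpos : 0 < k := by positivity
  set ε := c * Real.exp (-(k * b)) with hε
  have hεpos : 0 < ε := by positivity
  set φ : ℝ → ℝ → ℝ → ℝ := fun x y t =>
    ε * (Real.exp (k * (y - A * x ^ 2 + B * (t - t2))) - 1) with hφ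
  have dx : ∀ x y t, HasDerivAt (fun s => φ s y t)
      (ε * (Real.exp (k * (y - A * x ^ 2 + B * (t - t2))) * (k * (-(2 * A * x))))) x := by
    intro x y t
    have h1 : HasDerivAt (fun s => k * (y - A * s ^ 2 + B * (t - t2))) (k * (-(2 * A * x))) x := by
      have := ((((hasDerivAt_pow 2 x).const_mul A).const_sub y).add_const
        (B * (t - t2))).const_mul k
      refine this.congr_deriv ?_
      norm_num
      left; ring
    exact (h1.exp.sub_const 1).const_mul ε
  have dy : ∀ x y t, HasDerivAt (fun s => φ x s t)
      (ε * (Real.exp (k * (y - A * x ^ 2 + B * (t - t2))) * k)) y := by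
    intro x y t
    have h1 : HasDerivAt (fun s => k * (s - A * x ^ 2 + B * (t - t2))) k y := by
      have := (((hasDerivAt_id y).sub_const (A * x ^ 2)).add_const
        (B * (t - t2))).const_mul k
      exact this.congr_deriv (by simp)
    exact (h1.exp.sub_const 1).const_mul ε
  have dt : ∀ x y t, HasDerivAt (fun s => φ x y s)
      (ε * (Real.exp (k * (y - A * x ^ 2 + B * (t - t2))) * (k * B))) t := by
    intro x y t
    have h1 : HasDerivAt (fun s => k * (y - A * x ^ 2 + B * (s - t2))) (k * B) t := by
      have := ((((hasDerivAt_id t).sub_const t2).const_mul B).const_add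
        (y - A * x ^ 2)).const_mul k
      exact this.congr_deriv (by simp)
    exact (h1.exp.sub_const 1).const_mul ε
  have ex : ∀ x y t, pdx φ x y t =
      ε * (Real.exp (k * (y - A * x ^ 2 + B * (t - t2))) * (k * (-(2 * A * x)))) :=
    fun x y t => (dx x y t).deriv
  have ey : ∀ x y t, pdy φ x y t =
      ε * (Real.exp (k * (y - A * x ^ 2 + B * (t - t2))) * k) :=
    fun x y t => (dy x y t).deriv
  have et : ∀ x y t, pdt φ x y t =
      ε * (Real.exp (k * (y - A * x ^ 2 + B * (t - t2))) * (k * B)) :=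
    fun x y t => (dt x y t).deriv
  have dxx : ∀ x y t, HasDerivAt (fun s => pdx φ s y t)
      (ε * (Real.exp (k * (y - A * x ^ 2 + B * (t - t2))) * (k * (-(2 * A * x))) *
        (k * (-(2 * A * x))) + Real.exp (k * (y - A * x ^ 2 + B * (t - t2))) *
        (k * (-(2 * A))))) x := by
    intro x y t
    simp only [ex]
    have h1 : HasDerivAt (fun s => k * (y - A * s ^ 2 + B * (t - t2))) (k * (-(2 * A * x))) x := by
      have := ((((hasDerivAt_pow 2 x).const_mul A).const_sub y).add_const
        (B * (t - t2))).const_mul k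
      refine this.congr_deriv ?_
      norm_num
      left; ring
    have h2 : HasDerivAt (fun s => k * (-(2 * A * s))) (k * (-(2 * A))) x := by
      have := (((hasDerivAt_id x).const_mul (2 * A)).neg).const_mul k
      exact this.congr_deriv (by simp)
    exact (h1.exp.mul h2).const_mul ε
  have dyy : ∀ x y t, HasDerivAt (fun s => pdy φ x s t)
      (ε * (Real.exp (k * (y - A * x ^ 2 + B * (t - t2))) * k * k)) y := by
    intro x y t
    simp only [ey]
    have h1 : HasDerivAt (fun s => k * (s - A * x ^ 2 + B * (t - t2))) k y := by
      have := (((hasDerivAt_id y).sub_const (A * x ^ 2)).add_const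
        (B * (t - t2))).const_mul k
      exact this.congr_deriv (by simp)
    exact (h1.exp.mul_const k).const_mul ε
  have hsm : ∀ x ∈ Icc (-a) a, ∀ y ∈ Icc 0 b, ∀ t ∈ Icc t1 t2, C21At u x y t :=
    fun x hx y hy t ht => hsol.smooth (abs_le.2 ⟨by linarith [hx.1], by linarith [hx.2]⟩)
      ⟨hy.1, by linarith [hy.2]⟩ ⟨by linarith [ht.1], by linarith [ht.2]⟩
  have hcp := CP (fun _ _ => 0) φ u a b t1 t2 0 (by fun_prop)
    (by
      rintro ⟨x, y, t⟩ ⟨hx, hy, ht⟩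
      obtain ⟨_, _, _, _, _, _, h7, -⟩ := hsm x hx y hy t ht
      exact h7.continuousWithinAt)
    (fun x _ y _ t _ => ⟨(dx x y t).differentiableAt, (dy x y t).differentiableAt,
      (dt x y t).differentiableAt, (dxx x y t).differentiableAt, (dyy x y t).differentiableAt⟩)
    (fun x hx y hy t ht => by
      obtain ⟨h1, h2, h3, h4, h5, -⟩ := hsm x (Ioo_subset_Icc_self hx) y
        (Ioo_subset_Icc_self hy) t (Ioc_subset_Icc_self ht)
      exact ⟨h1, h2, h3, h4, h5⟩)
    (fun x hx y hy t ht => by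
      have exx : pdxx φ x y t = _ := (dxx x y t).deriv
      have eyy : pdyy φ x y t = _ := (dyy x y t).deriv
      rw [exx, eyy, et]
      set E := Real.exp (k * (y - A * x ^ 2 + B * (t - t2))) with hE
      have hEp : 0 < E := Real.exp_pos _
      have : ε * (E * (k * B)) - (ε * (E * (k * (-(2 * A * x))) * (k * (-(2 * A * x)))
          + E * (k * (-(2 * A)))) + ε * (E * k * k))
          = -(ε * E * (k * (2 * A * x)) ^ 2) + ε * E * k * (B + 2 * A - k) := by ring
      rw [this, hk]
      have : 0 ≤ ε * E * ((B + 2 * A) * (2 * A * x)) ^ 2 := by positivity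
      simp only [sub_self, mul_zero]
      linarith)
    (fun x hx y hy t ht => by
      have := hsol.pde (x := x) (y := y) (abs_lt.2 ⟨by linarith [hx.1], by linarith [hx.2]⟩)
        ⟨hy.1, by linarith [hy.2]⟩ (⟨by linarith [ht.1], by linarith [ht.2]⟩ : t ∈ Ioo 0 T)
      rw [this]
      exact Real.rpow_nonneg (Real.sqrt_nonneg _) _)
    (fun x hx y hy t ht hor => by
      have hun : 0 ≤ u x y t := hsol.nonneg (abs_le.2 ⟨by linarith [hx.1], by linarith [hx.2]⟩)
        ⟨hy.1, by linarith [hy.2]⟩ ⟨by linarith [ht.1], by linarith [ht.2]⟩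
      have hAx : 0 ≤ A * x ^ 2 := by positivity
      have hBt : B * (t - t2) ≤ 0 := mul_nonpos_of_nonneg_of_nonpos hBpos.le (by linarith [ht.2])
      rw [add_zero]
      have neg : y - A * x ^ 2 + B * (t - t2) ≤ 0 → φ x y t ≤ u x y t := by
        intro h
        refine le_trans ?_ hun
        apply mul_nonpos_of_nonneg_of_nonpos hεpos.le
        have : Real.exp (k * (y - A * x ^ 2 + B * (t - t2))) ≤ 1 := by
          rw [Real.exp_le_one_iff]
          exact mul_nonpos_of_nonneg_of_nonpos hkpos.le h
        linarith
      have hAa : A * a ^ 2 = b := by rw [hA]; field_simp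
      rcases hor with e | e | e | e | e
      · apply neg
        have : A * x ^ 2 = b := by rw [e, neg_sq, hAa]
        linarith [hy.2]
      · apply neg
        have : A * x ^ 2 = b := by rw [e, hAa]
        linarith [hy.2]
      · apply neg
        linarith
      · have h1 := hu x hx t ht
        subst e
        refine le_trans ?_ h1
        have h2 : Real.exp (k * (y - A * x ^ 2 + B * (t - t2))) ≤ Real.exp (k * y) := by
          apply Real.exp_le_exp.2
          exact mul_le_mul_of_nonneg_left (by linarith) hkpos.le
        have h3 : ε * Real.exp (k * y) = c := by
          rw [hε, mul_assoc, ← Real.exp_add]; simp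
        have h4 := mul_le_mul_of_nonneg_left h2 hεpos.le
        change ε * (Real.exp (k * (y - A * x ^ 2 + B * (t - t2))) - 1) ≤ c
        linarith
      · apply neg
        have : B * (t - t2) = -b := by
          have : t2 - t1 ≠ 0 := by linarith
          rw [hB, e]; field_simp; ring
        linarith [hy.2])
  have h00 : |(0:ℝ)| < L := by simpa using hL
  have ht2' : t2 ∈ Ioo 0 T := ⟨by linarith, ht2⟩
  have hfin := D1right' (fun s => u 0 s t2) 0 (-(ε * k)) b hb
    (hsol.smooth h00.le ⟨le_rfl, hL.le⟩ ht2').2.1 (fun h h1 h2 => by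
      have := hcp 0 ⟨by linarith, ha.le⟩ h ⟨h1.le, h2.le⟩ t2 ⟨ht12.le, le_rfl⟩
      simp only [hφ] at this
      rw [zero_add, hsol.bc h00 ht2']
      have h3 := Real.add_one_le_exp (k * h)
      have h4 := mul_le_mul_of_nonneg_left h3 hεpos.le
      simp only [sub_self, mul_zero, add_zero, ne_eq, OfNat.ofNat_ne_zero, not_false_eq_true,
        zero_pow, sub_zero] at this
      linarith)
  have : 0 < ε * k := by positivity
  change _ ≤ pdy u 0 0 t2 at hfin
  linarith

/-- Proposition 2.5: one-dimensional lower estimates on the line `x = 0`.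
Here `β = 1/(p-1)`, `d_p = β^β` and `c_p = (1-β)⁻¹ d_p`. -/
theorem lower_1d_estimates (p L T : ℝ) (hp : 2 < p) (hL : 0 < L) (hT : 0 < T)
    (u : ℝ → ℝ → ℝ → ℝ)
    (hsol : ClassicalSolution p L T u) (hgbu : IsolatedGBU L T u)
    (hext : ExtC21 L T u) (hmon : MonCond L T u) :
    ∃ C₁ ρ : ℝ, 0 < C₁ ∧ 0 < ρ ∧ ρ < L ∧ ρ < T ∧
      (∀ y t : ℝ, y ∈ Ioo (0:ℝ) ρ → t ∈ Ico (T - ρ) T →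
        ((pdy u 0 0 t) ^ (1 - p) + (p - 1) * y) ^ (-(1/(p-1))) - C₁ ≤ pdy u 0 y t) ∧
      (∀ y : ℝ, y ∈ Ioo (0:ℝ) ρ →
        ((1/(p-1) : ℝ) ^ (1/(p-1))) * y ^ (-(1/(p-1))) - C₁ ≤ pdy u 0 y T) ∧
      (∀ y : ℝ, y ∈ Ioo (0:ℝ) ρ →
        (1 - 1/(p-1))⁻¹ * ((1/(p-1) : ℝ) ^ (1/(p-1))) * y ^ (1 - 1/(p-1)) - C₁ * y
          ≤ u 0 y T) := by
  have h00 : |(0:ℝ)| < L := by simpa using hL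
  have hp1 : 0 < p - 1 := by linarith
  have hp2 : 0 < p - 2 := by linarith
  obtain ⟨K, hK0, hK⟩ := GA_bound hL hT hext
  obtain ⟨b, hb, hbL, hKb⟩ : ∃ b > 0, b ≤ L/4 ∧ (K + 2) * b ≤ 1 := by
    refine ⟨min (L/4) (1/(K+2)), lt_min (by linarith) (by positivity), min_le_left _ _, ?_⟩
    have h1 := min_le_right (L/4) (1/(K+2))
    have h2 := mul_le_mul_of_nonneg_left h1 (show 0 ≤ K + 2 by linarith)
    refine h2.trans (le_of_eq ?_)
    field_simp
  have hseq : ∀ n : ℕ, ∃ t, t ∈ Ico (T/2) T ∧ T - 1 / ((n:ℝ) + 1) < t ∧ (n:ℝ) < pdy u 0 0 t :=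
    fun n => uy_unbdd hL hT hsol hgbu hext hmon n (1 / ((n:ℝ) + 1)) (by positivity)
  choose τ hτ hτ2 hτ3 using hseq
  have hτT : Tendsto τ atTop (nhds T) := by
    refine tendsto_of_tendsto_of_tendsto_of_le_of_le (g := fun n : ℕ => T - 1 / ((n:ℝ) + 1))
      (h := fun _ => T) ?_ tendsto_const_nhds (fun n => (hτ2 n).le) (fun n => (hτ n).2.le)
    simpa using (tendsto_one_div_add_atTop_nhds_zero_nat (𝕜 := ℝ)).const_sub T
  have hτv : Tendsto (fun n => pdy u 0 0 (τ n)) atTop atTop :=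
    tendsto_atTop_mono (fun n => (hτ3 n).le) tendsto_natCast_atTop_atTop
  have hτm : Tendsto (fun n => (pdy u 0 0 (τ n)) ^ (1 - p)) atTop (nhds 0) := by
    have := (tendsto_rpow_neg_atTop hp1).comp hτv
    simpa [Function.comp_def] using this
  have hτpos : ∀ n, 0 < pdy u 0 0 (τ n) := fun n => (Nat.cast_nonneg n).trans_lt (hτ3 n)
  have hbase : ∀ y, Tendsto (fun n => (pdy u 0 0 (τ n)) ^ (1 - p) + (p - 1) * y) atTop
      (nhds ((p - 1) * y)) := fun y => by simpa using hτm.add_const ((p - 1) * y)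
  have hC : ∀ y ∈ Ioc 0 b, C21At u 0 y T := by
    intro y hy
    refine hext (by simp; linarith) ⟨hy.1.le, by linarith [hy.2]⟩ ⟨by linarith, le_rfl⟩ ?_
    rintro ⟨-, h, -⟩
    exact hy.1.ne' h
  have hβ1 : 0 < 1 - 1/(p-1) := by
    rw [sub_pos, div_lt_one hp1]; linarith
  have hii : ∀ y ∈ Ioc 0 b, ((1/(p-1) : ℝ) ^ (1/(p-1))) * y ^ (-(1/(p-1))) - (K + 2)
      ≤ pdy u 0 y T - (K + 2) + (K + 2) * y := by
    intro y hy
    obtain ⟨_, _, _, _, _, _, _, _, h9, -⟩ := hC y hy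
    have c1 : ContinuousAt (fun s => pdy u 0 y s) T :=
      ContinuousAt.comp (f := fun s : ℝ => ((0:ℝ), y, s)) (x := T) h9 (by fun_prop)
    have l1 := c1.tendsto.comp hτT
    have hne : (p - 1) * y ≠ 0 := (mul_pos hp1 hy.1).ne'
    have l2 := ((hbase y).rpow_const (p := -(1/(p-1))) (Or.inl hne)).sub_const ((K + 2) * y)
    have := le_of_tendsto_of_tendsto' l2 l1 (fun n =>
      est_i hp hL hT hsol hext hmon hK0 hK hbL hKb (hτ n) (hτpos n) y ⟨hy.1.le, hy.2⟩)
    rw [Real.mul_rpow hp1.le hy.1.le] at this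
    have e : (1/(p-1) : ℝ) ^ (1/(p-1)) = (p - 1) ^ (-(1/(p-1))) := by
      rw [Real.rpow_neg hp1.le, ← Real.inv_rpow hp1.le, one_div]
    rw [e]
    linarith
  have hiii : ∀ y ∈ Ioc 0 b,
      (1 - 1/(p-1))⁻¹ * ((1/(p-1) : ℝ) ^ (1/(p-1))) * y ^ (1 - 1/(p-1)) - (K + 2) * y
          ≤ u 0 y T := by
    intro y hy
    obtain ⟨_, _, _, _, _, _, h7, -⟩ := hC y hy
    have c1 : ContinuousAt (fun s => u 0 y s) T :=
      ContinuousAt.comp (f := fun s : ℝ => ((0:ℝ), y, s)) (x := T) h7 (by fun_prop)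
    have l1 := c1.tendsto.comp hτT
    have l2 := ((((hbase y).rpow_const (p := 1 - 1/(p-1)) (Or.inr hβ1.le)).sub
      (hτm.rpow_const (p := 1 - 1/(p-1)) (Or.inr hβ1.le))).div_const (p - 2)).sub_const
      ((K + 2) * y)
    have := le_of_tendsto_of_tendsto' l2 l1 (fun n =>
      est_iii hp hL hT hsol hext hmon hK0 hK hbL hKb (hτ n) (hτpos n) y ⟨hy.1.le, hy.2⟩)
    rw [Real.mul_rpow hp1.le hy.1.le, Real.zero_rpow hβ1.ne', sub_zero] at this
    have e : (1/(p-1) : ℝ) ^ (1/(p-1)) = (p - 1) ^ (-(1/(p-1))) := by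
      rw [Real.rpow_neg hp1.le, ← Real.inv_rpow hp1.le, one_div]
    have e2 : (p - 1) ^ (1 - 1/(p-1)) = (p - 1) * (p - 1) ^ (-(1/(p-1))) := by
      rw [sub_eq_add_neg 1 (1/(p-1)), Real.rpow_add hp1, Real.rpow_one]
    have e3 : (1 - 1/(p-1))⁻¹ = (p - 1) / (p - 2) := by
      have : 1 - 1/(p-1) = (p - 2) / (p - 1) := by field_simp; ring
      rw [this, inv_div]
    rw [e, e3]
    rw [e2] at this
    refine le_trans (le_of_eq ?_) this
    ring
  -- positivity
  obtain ⟨y0, hy0, hu0⟩ : ∃ y0 ∈ Ioc 0 b, 0 < u 0 y0 T := by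
    set c := (1 - 1/(p-1))⁻¹ * ((1/(p-1) : ℝ) ^ (1/(p-1))) with hc
    have hcpos : 0 < c := by positivity
    have hβ : 0 < 1/(p-1) := by positivity
    have hlim : Tendsto (fun y : ℝ => c - (K + 2) * y ^ (1/(p-1))) (nhds 0) (nhds c) := by
      have h1 : ContinuousAt (fun y : ℝ => y ^ (1/(p-1))) 0 :=
        Real.continuousAt_rpow_const _ _ (Or.inr hβ.le)
      have := (h1.tendsto.const_mul (K + 2)).const_sub c
      rw [Real.zero_rpow hβ.ne', mul_zero, sub_zero] at this
      exact this
    have hev := (hlim.mono_left (nhdsWithin_le_nhds (s := Ioi 0))).eventually (lt_mem_nhds hcpos)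
    obtain ⟨y, hy1, hy2⟩ := (hev.and (Ioo_mem_nhdsGT hb)).exists
    refine ⟨y, ⟨hy2.1, hy2.2.le⟩, ?_⟩
    refine lt_of_lt_of_le ?_ (hiii y ⟨hy2.1, hy2.2.le⟩)
    have e : y = y ^ (1 - 1/(p-1)) * y ^ (1/(p-1)) := by
      rw [← Real.rpow_add hy2.1]; simp
    have hpos := mul_pos (Real.rpow_pos_of_pos hy2.1 (1 - 1/(p-1))) hy1
    have e2 : (K + 2) * y = (K + 2) * (y ^ (1 - 1/(p-1)) * y ^ (1/(p-1))) := by rw [← e]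
    rw [e2]
    linarith
  obtain ⟨_, _, _, _, _, _, h7, -⟩ := hC y0 hy0
  have hev := h7.tendsto.eventually (lt_mem_nhds (show u 0 y0 T / 2 < u 0 y0 T by linarith))
  obtain ⟨d, hd, hball⟩ := Metric.eventually_nhds_iff.1 hev
  set r := min (d/2) (min (L/2) (T/4)) with hr
  have hr0 : 0 < r := lt_min (by linarith) (lt_min (by linarith) (by linarith))
  have hrd : r ≤ d/2 := min_le_left _ _
  have hrL : r ≤ L/2 := (min_le_right _ _).trans (min_le_left _ _)
  have hrT : r ≤ T/4 := (min_le_right _ _).trans (min_le_right _ _)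
  have hposu : ∀ t, T - r < t → t < T → 0 < pdy u 0 0 t := by
    intro t h1 h2
    refine hopf hL hsol r y0 (T - r) t (u 0 y0 T / 2) hr0 (by linarith) hy0.1
      (by linarith [hy0.2]) (by linarith) h1 h2 (by linarith) ?_
    intro x hx s hs
    refine (hball (y := (x, y0, s)) ?_).le
    rw [Prod.dist_eq, Prod.dist_eq]
    refine max_lt ?_ (max_lt ?_ ?_)
    · simp only [Real.dist_eq, sub_zero]
      exact abs_lt.2 ⟨by linarith [hx.1], by linarith [hx.2]⟩
    · simpa using hd
    · simp only [Real.dist_eq]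
      exact abs_lt.2 ⟨by linarith [hs.1], by linarith [hs.2]⟩
  have hρb := min_le_left b (r/2)
  have hρr := min_le_right b (r/2)
  have hmul : ∀ y, 0 < y → y < b → (K + 2) * y ≤ K + 2 := by
    intro y h1 h2
    have := mul_le_mul_of_nonneg_left h2.le (show 0 ≤ K + 2 by linarith)
    linarith
  refine ⟨K + 2, min b (r/2), by linarith, lt_min hb (by linarith), by linarith, by linarith,
    ?_, ?_, ?_⟩
  · intro y t hy ht
    have hyb : y < b := hy.2.trans_le hρb
    have := est_i hp hL hT hsol hext hmon hK0 hK hbL hKb (t := t)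
      ⟨by linarith [ht.1], ht.2⟩ (hposu t (by linarith [ht.1]) ht.2) y ⟨hy.1.le, hyb.le⟩
    have := hmul y hy.1 hyb
    linarith
  · intro y hy
    have hyb : y < b := hy.2.trans_le hρb
    have := hii y ⟨hy.1, hyb.le⟩
    have := hmul y hy.1 hyb
    linarith
  · intro y hy
    exact hiii y ⟨hy.1, hy.2.le.trans hρb⟩
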